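/- There do not exist functions s_x, s_y : Fin 3 → ℝ, each taking values in {-1, 1}, such that s_x(0)·s_y(1)·s_y(2) = 1, s_y(0)·s_x(1)·s_y(2) = 1, s_y(0)·s_y(1)·s_x(2) = 1, and s_x(0)·s_x(1)·s_x(2) = -1. (In the three-particle GHZ setting, this means the outcomes of all six spin measurements σ_x(k), σ_y(k), k = 1,2,3, cannot simultaneously have pre-existing values consistent with the quantum-mechanical predictions E(+) and E(-).) -/

import Mathlib

/-- In Mermin's three-particle GHZ setting, the outcomes of all six spin
measurements σ_x(k), σ_y(k), k = 1,2,3, cannot simultaneously have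
pre-existing values in {-1, 1} consistent with the quantum-mechanical
predictions E(+) and E(-). -/
theorem ghz_no_preexisting_values :
    ¬ ∃ (s_x s_y : Fin 3 → ℝ),
      (∀ i, s_x i = -1 ∨ s_x i = 1) ∧
      (∀ i, s_y i = -1 ∨ s_y i = 1) ∧
      s_x 0 * s_y 1 * s_y 2 = 1 ∧
      s_y 0 * s_x 1 * s_y 2 = 1 ∧
      s_y 0 * s_y 1 * s_x 2 = 1 ∧
      s_x 0 * s_x 1 * s_x 2 = -1 := by
  rintro ⟨x, y, -, -, h₀, h₁, h₂, h⟩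
  have key : x 0 * x 1 * x 2 * (y 0 * y 1 * y 2) ^ 2 = 1 := by
    calc _ = (x 0 * y 1 * y 2) * (y 0 * x 1 * y 2) * (y 0 * y 1 * x 2) := by ring
      _ = 1 := by rw [h₀, h₁, h₂]; norm_num
  rw [h] at key
  linarith [sq_nonneg (y 0 * y 1 * y 2)]
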